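/- arXiv:1110.6027 — 4 statements merged into one kernel-verified Lean document; each statement's English description precedes it below -/
import Mathlib

section
/- Let (X, Σ, μ) be a probability space and let Q ⊆ Σ be a family of measurable subsets of X. Then the weighted μ-entropy of Q is bounded above by the classical μ-entropy of Q, i.e. Hv(μ;Q) ≤ H(μ;Q). -/
open MeasureTheory ENNReal

/-- The Shannon function `sh(x) = -x·log₂ x` (with `sh 0 = 0`). -/
noncomputable def sh (x : ℝ) : ℝ := -(x * Real.logb 2 x)

/-- `P` is a `μ`-partition of `X`: a countable family of pairwise disjoint
measurable sets covering `X` up to a `μ`-null set. -/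
def IsMuPartition {X : Type*} [MeasurableSpace X] (μ : Measure X) (P : Set (Set X)) : Prop :=
  P.Countable ∧ (∀ s ∈ P, MeasurableSet s) ∧ P.Pairwise Disjoint ∧ μ (⋃₀ P)ᶜ = 0

/-- The `μ`-entropy `h(μ;P) = Σ_{P∈P} sh(μ(P))` of a family of sets. -/
noncomputable def partEntropy {X : Type*} [MeasurableSpace X] (μ : Measure X)
    (P : Set (Set X)) : ℝ≥0∞ :=
  ∑' s : P, ENNReal.ofReal (sh (μ s).toReal)

/-- `P ≺ Q` : every element of `P` is contained in some element of `Q`. -/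
def Finer {X : Type*} (P Q : Set (Set X)) : Prop := ∀ p ∈ P, ∃ q ∈ Q, p ⊆ q

/-- The (classical) `μ`-entropy of a family `Q`:
`H(μ;Q) = inf { h(μ;P) : P a μ-partition, P ≺ Q }`, with `inf ∅ = ∞`. -/
noncomputable def entropyH {X : Type*} [MeasurableSpace X] (μ : Measure X)
    (Q : Set (Set X)) : ℝ≥0∞ :=
  ⨅ (P : Set (Set X)) (_ : IsMuPartition μ P) (_ : Finer P Q), partEntropy μ P

/-- `m ∈ V(μ;Q)` : a weighting of `Q`, i.e. `m : Q → Measure X` with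
`m_Q(X \ Q) = 0` for all `Q ∈ Q` and `Σ_{Q∈Q} m_Q = μ`. -/
def IsWeighting {X : Type*} [MeasurableSpace X] (μ : Measure X) (Q : Set (Set X))
    (m : Q → Measure X) : Prop :=
  (∀ q : Q, m q ((q : Set X))ᶜ = 0) ∧ Measure.sum m = μ

/-- The weighted `μ`-entropy of `m ∈ V(μ;Q)` : `hv(μ;m) = Σ_{Q∈Q} sh(m_Q(X))`. -/
noncomputable def wEntropy {X : Type*} [MeasurableSpace X] (Q : Set (Set X))
    (m : Q → Measure X) : ℝ≥0∞ :=
  ∑' q : Q, ENNReal.ofReal (sh ((m q) Set.univ).toReal)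

/-- The weighted `μ`-entropy of `Q` : `Hv(μ;Q) = inf { hv(μ;m) : m ∈ V(μ;Q) }`,
with `inf ∅ = ∞`. -/
noncomputable def entropyHv {X : Type*} [MeasurableSpace X] (μ : Measure X)
    (Q : Set (Set X)) : ℝ≥0∞ :=
  ⨅ (m : Q → Measure X) (_ : IsWeighting μ Q m), wEntropy Q m

/-- The family of all closed balls of radius `δ`. -/
def ballFam (X : Type*) [PseudoMetricSpace X] (δ : ℝ) : Set (Set X) :=
  Set.range (fun x : X => Metric.closedBall x δ)

/-- The lower entropy dimension `liminf_{δ→0⁺} H(μ;B_δ)/(-log₂ δ)`. -/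
noncomputable def ldimE {X : Type*} [PseudoMetricSpace X] [MeasurableSpace X]
    (μ : Measure X) : ℝ≥0∞ :=
  Filter.liminf (fun δ : ℝ => entropyH μ (ballFam X δ) / ENNReal.ofReal (-Real.logb 2 δ))
    (nhdsWithin 0 (Set.Ioi 0))

/-- The upper entropy dimension `limsup_{δ→0⁺} H(μ;B_δ)/(-log₂ δ)`. -/
noncomputable def udimE {X : Type*} [PseudoMetricSpace X] [MeasurableSpace X]
    (μ : Measure X) : ℝ≥0∞ :=
  Filter.limsup (fun δ : ℝ => entropyH μ (ballFam X δ) / ENNReal.ofReal (-Real.logb 2 δ))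
    (nhdsWithin 0 (Set.Ioi 0))

/-- `N_δ(S)` : the smallest number of closed balls of radius `δ` needed to cover `S`. -/
noncomputable def coverNum {X : Type*} [PseudoMetricSpace X] (S : Set X) (δ : ℝ) : ℝ≥0∞ :=
  ⨅ (t : Finset X) (_ : S ⊆ ⋃ x ∈ t, Metric.closedBall x δ), (t.card : ℝ≥0∞)

/-- The natural logarithm on `ℝ≥0∞` (with `log ∞ = ∞`), truncated to `ℝ≥0∞`. -/
noncomputable def logENN (x : ℝ≥0∞) : ℝ≥0∞ :=
  if x = ⊤ then ⊤ else ENNReal.ofReal (Real.log x.toReal)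

/-- The upper box dimension `limsup_{δ→0⁺} log N_δ(S)/(-log δ)`. -/
noncomputable def ubdimB {X : Type*} [PseudoMetricSpace X] (S : Set X) : ℝ≥0∞ :=
  Filter.limsup (fun δ : ℝ => logENN (coverNum S δ) / ENNReal.ofReal (-Real.log δ))
    (nhdsWithin 0 (Set.Ioi 0))

/-- The upper local dimension `D̄_μ(x) = limsup_{δ→0⁺} log μ(B(x,δ))/log δ`
(interpreted as `∞` when `μ(B(x,δ)) = 0`). -/
noncomputable def upLocalDim {X : Type*} [PseudoMetricSpace X] [MeasurableSpace X]
    (μ : Measure X) (x : X) : ℝ≥0∞ :=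
  Filter.limsup
    (fun δ : ℝ => if μ (Metric.closedBall x δ) = 0 then ⊤ else
      ENNReal.ofReal (Real.log (μ (Metric.closedBall x δ)).toReal / Real.log δ))
    (nhdsWithin 0 (Set.Ioi 0))

/-- The truncated Shannon function factors as a product of extended nonnegative reals. -/
theorem ofReal_sh_toReal {x : ℝ≥0∞} (hx : x ≠ ∞) :
    ENNReal.ofReal (sh x.toReal) = x * ENNReal.ofReal (-Real.logb 2 x.toReal) := by
  rw [sh, ← mul_neg, ENNReal.ofReal_mul ENNReal.toReal_nonneg, ENNReal.ofReal_toReal hx]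

/-- The Shannon function is countably subadditive on families of finite total mass. -/
theorem ofReal_sh_tsum_le {ι : Type*} (a : ι → ℝ≥0∞) (h : ∑' i, a i ≠ ∞) :
    ENNReal.ofReal (sh (∑' i, a i).toReal) ≤ ∑' i, ENNReal.ofReal (sh (a i).toReal) := by
  rw [ofReal_sh_toReal h, ← ENNReal.tsum_mul_right]
  refine ENNReal.tsum_le_tsum fun i => ?_
  have hi : a i ≤ ∑' j, a j := ENNReal.le_tsum i
  have hi' : a i ≠ ∞ := ne_top_of_le_ne_top h hi
  rw [ofReal_sh_toReal hi']
  rcases eq_or_ne (a i) 0 with h0 | h0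
  · simp [h0]
  · gcongr
    · norm_num
    · exact ENNReal.toReal_pos h0 hi'

/-- Summing the restrictions of `μ` to the cells of a `μ`-partition recovers `μ`. -/
theorem IsMuPartition.sum_restrict {X : Type*} [MeasurableSpace X] {μ : Measure X}
    {P : Set (Set X)} (hP : IsMuPartition μ P) :
    Measure.sum (fun p : P => μ.restrict (p : Set X)) = μ := by
  obtain ⟨hc, hm, hd, h0⟩ := hP
  have := hc.to_subtype
  rw [← Measure.restrict_iUnion (fun i j hij => hd i.2 j.2 (Subtype.coe_ne_coe.2 hij))
    (fun i => hm i i.2), ← Set.sUnion_eq_iUnion]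
  exact Measure.restrict_eq_self_of_ae_mem (mem_ae_iff.2 h0)

/-- Collecting the cells of a `μ`-partition along a map `f : P → Q` sending each cell to a set
containing it gives a weighting of `Q`. -/
theorem IsMuPartition.isWeighting_sum_fiber {X : Type*} [MeasurableSpace X] {μ : Measure X}
    {P Q : Set (Set X)} (hP : IsMuPartition μ P) (hQ : ∀ q ∈ Q, MeasurableSet q)
    (f : P → Q) (hf : ∀ p : P, (p : Set X) ⊆ f p) :
    IsWeighting μ Q (fun q => Measure.sum fun p : {p // f p = q} => μ.restrict (p.1 : Set X)) := by
  refine ⟨fun q => ?_, ?_⟩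
  · rw [Measure.sum_apply _ (hQ q q.2).compl, ENNReal.tsum_eq_zero]
    rintro ⟨p, rfl⟩
    rw [Measure.restrict_apply (hQ _ (f p).2).compl,
      (Set.disjoint_compl_left_iff_subset.2 (hf p)).inter_eq, measure_empty]
  · conv_rhs => rw [← hP.sum_restrict]
    ext s hs
    simp only [Measure.sum_apply _ hs]
    rw [← (Equiv.sigmaFiberEquiv f).tsum_eq, ENNReal.tsum_sigma']
    rfl

/-- Proposition 1 of the paper: for a probability measure `μ` and a family
`Q ⊆ Σ` of measurable sets, the weighted entropy is at most the classical entropy: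
`Hv(μ;Q) ≤ H(μ;Q)`. -/
theorem weighted_entropy_le_entropy {X : Type*} [MeasurableSpace X]
    (μ : Measure X) [IsProbabilityMeasure μ]
    (Q : Set (Set X)) (hQ : ∀ q ∈ Q, MeasurableSet q) :
    entropyHv μ Q ≤ entropyH μ Q := by
  refine le_iInf fun P => le_iInf fun hP => le_iInf fun hPQ => ?_
  choose g hgQ hg using hPQ
  let f : P → Q := fun p => ⟨g p p.2, hgQ p p.2⟩
  have hW := hP.isWeighting_sum_fiber hQ f fun p => hg p p.2
  refine (iInf₂_le _ hW).trans ?_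
  rw [wEntropy, partEntropy, ← (Equiv.sigmaFiberEquiv f).tsum_eq, ENNReal.tsum_sigma']
  refine ENNReal.tsum_le_tsum fun q => ?_
  have hfin := ((Measure.le_sum _ q).trans_eq hW.2 Set.univ).trans_lt (measure_lt_top μ _)
  simp only [Measure.sum_apply _ MeasurableSet.univ, Measure.restrict_apply_univ] at hfin ⊢
  exact ofReal_sh_tsum_le _ hfin.ne
end

section
/- Let (X, Σ, μ) be a probability space, let Q = {Q_i}_{i∈I} ⊆ Σ where I = ℕ or I = {1,…,N} for some N ∈ ℕ, and let m ∈ V(μ;Q). Assume that μ(X \ ⋃_{i∈I} Q_i) = 0 and that the sequence i ↦ m_{Q_i}(X) is nonincreasing. Define P = {P_i}_{i∈I} by P_1 := Q_1 and P_i := Q_i \ ⋃_{k=1}^{i-1} Q_k for i ≥ 2. Then P is a μ-partition of X, P ≺ Q, and hv(μ;m) ≥ h(μ;P). -/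
open MeasureTheory ENNReal

lemma sh_zero : sh 0 = 0 := by simp [sh]

/-- The information content `-log₂ a`, with value `∞` at `a = 0`. -/
noncomputable def infoContent (a : ℝ≥0∞) : ℝ≥0∞ :=
  if a = 0 then ⊤ else ENNReal.ofReal (-Real.logb 2 a.toReal)

lemma infoContent_le_of_le {a b : ℝ≥0∞} (hb : b ≤ 1) (hab : a ≤ b) :
    infoContent b ≤ infoContent a := by
  by_cases ha0 : a = 0
  · simp [infoContent, ha0]
  have hb0 : b ≠ 0 := fun h => ha0 (le_antisymm (h ▸ hab) zero_le)
  have hbtop : b ≠ ⊤ := ne_top_of_le_ne_top one_ne_top hb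
  have hatop : a ≠ ⊤ := ne_top_of_le_ne_top hbtop hab
  simp only [infoContent, ha0, hb0, if_false]
  exact ENNReal.ofReal_le_ofReal (neg_le_neg (Real.logb_le_logb_of_le one_lt_two
    (ENNReal.toReal_pos ha0 hatop) (ENNReal.toReal_mono hbtop hab)))

lemma mul_infoContent_self {a : ℝ≥0∞} (ha : a ≤ 1) :
    a * infoContent a = ENNReal.ofReal (sh a.toReal) := by
  by_cases ha0 : a = 0
  · simp [ha0, sh_zero]
  have hatop : a ≠ ⊤ := ne_top_of_le_ne_top one_ne_top ha
  simp only [infoContent, ha0, if_false]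
  nth_rw 1 [← ENNReal.ofReal_toReal hatop]
  rw [← ENNReal.ofReal_mul ENNReal.toReal_nonneg, sh, mul_neg]

/-- The pointwise form of the Gibbs inequality. -/
lemma sh_add_le_mul_infoContent_add {p a : ℝ≥0∞} (hp : p ≤ 1) (ha : a ≤ 1) :
    ENNReal.ofReal (sh p.toReal) + p * ENNReal.ofReal (Real.log 2)⁻¹ ≤
      p * infoContent a + a * ENNReal.ofReal (Real.log 2)⁻¹ := by
  by_cases hp0 : p = 0
  · simp [hp0, sh_zero]
  by_cases ha0 : a = 0
  · simp [infoContent, ha0, ENNReal.mul_top hp0]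
  have hptop : p ≠ ⊤ := ne_top_of_le_ne_top one_ne_top hp
  have hatop : a ≠ ⊤ := ne_top_of_le_ne_top one_ne_top ha
  simp only [infoContent, ha0, if_false]
  lift p to NNReal using hptop
  lift a to NNReal using hatop
  have hp' : (0 : ℝ) < p := by
    have : p ≠ 0 := by exact_mod_cast hp0
    exact_mod_cast pos_iff_ne_zero.2 this
  have ha' : (0 : ℝ) < a := by
    have : a ≠ 0 := by exact_mod_cast ha0
    exact_mod_cast pos_iff_ne_zero.2 this
  have hp1 : (p : ℝ) ≤ 1 := by exact_mod_cast hp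
  have ha1 : (a : ℝ) ≤ 1 := by exact_mod_cast ha
  have hl : 0 < Real.log 2 := Real.log_pos one_lt_two
  have hc : 0 < (Real.log 2)⁻¹ := inv_pos.2 hl
  have hlp : Real.logb 2 p ≤ 0 := Real.logb_nonpos one_lt_two hp'.le hp1
  have hla : Real.logb 2 a ≤ 0 := Real.logb_nonpos one_lt_two ha'.le ha1
  have hsh : 0 ≤ sh p := neg_nonneg.2 (mul_nonpos_of_nonneg_of_nonpos hp'.le hlp)
  simp only [ENNReal.coe_toReal]
  rw [← ENNReal.ofReal_coe_nnreal, ← ENNReal.ofReal_coe_nnreal,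
    ← ENNReal.ofReal_mul hp'.le, ← ENNReal.ofReal_mul hp'.le, ← ENNReal.ofReal_mul ha'.le,
    ← ENNReal.ofReal_add hsh (by positivity),
    ← ENNReal.ofReal_add (mul_nonneg hp'.le (neg_nonneg.2 hla)) (by positivity)]
  apply ENNReal.ofReal_le_ofReal
  have key : (p : ℝ) * (Real.log a - Real.log p) ≤ a - p := by
    rw [← Real.log_div ha'.ne' hp'.ne']
    calc (p : ℝ) * Real.log (a / p) ≤ p * (a / p - 1) :=
          mul_le_mul_of_nonneg_left (Real.log_le_sub_one_of_pos (by positivity)) hp'.le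
      _ = a - p := by field_simp
  have := mul_le_mul_of_nonneg_right key hc.le
  simp only [sh, Real.logb, div_eq_mul_inv]
  linarith

/-- Tail sums of a sequence, obtained from its initial sums and its total. -/
lemma sum_range_add_tsum_ite (p : ℕ → ℝ≥0∞) (k : ℕ) :
    ∑ i ∈ Finset.range k, p i + ∑' i, (if k ≤ i then p i else 0) = ∑' i, p i := by
  have h : ∑ i ∈ Finset.range k, p i = ∑' i, (if i < k then p i else 0) := by
    rw [tsum_eq_sum (s := Finset.range k)]
    · exact Finset.sum_congr rfl fun i hi => by simp [Finset.mem_range.1 hi]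
    · intro i hi
      simp [Finset.mem_range] at hi
      simp [hi]
  rw [h, ← ENNReal.tsum_add]
  refine tsum_congr fun i => ?_
  by_cases hi : i < k
  · simp [hi, not_le.2 hi]
  · simp [hi, not_lt.1 hi]

/-- Summation by parts: moving mass towards larger indices increases the integral of a monotone
sequence. -/
lemma tsum_mul_le_tsum_mul_of_monotone {p a w : ℕ → ℝ≥0∞} (hw : Monotone w)
    (htail : ∀ k, ∑' i, (if k ≤ i then p i else 0) ≤ ∑' i, (if k ≤ i then a i else 0)) :
    ∑' i, p i * w i ≤ ∑' i, a i * w i := by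
  obtain ⟨d, hd⟩ : ∃ d : ℕ → ℝ≥0∞, ∀ i, w i = ∑ k ∈ Finset.range (i + 1), d k := by
    refine ⟨fun k => Nat.casesOn k (w 0) fun j => w (j + 1) - w j, fun i => ?_⟩
    induction i with
    | zero => simp
    | succ i ih =>
      rw [Finset.sum_range_succ, ← ih]
      exact (add_tsub_cancel_of_le (hw i.le_succ)).symm
  have swap (q : ℕ → ℝ≥0∞) :
      ∑' i, q i * w i = ∑' k, d k * ∑' i, (if k ≤ i then q i else 0) := by
    have h (i : ℕ) : q i * w i = ∑' k, d k * (if k ≤ i then q i else 0) := by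
      rw [hd, tsum_eq_sum (s := Finset.range (i + 1)), Finset.mul_sum]
      · refine Finset.sum_congr rfl fun k hk => ?_
        rw [if_pos (Nat.lt_succ_iff.1 (Finset.mem_range.1 hk)), mul_comm]
      · intro k hk
        rw [if_neg (fun h => hk (Finset.mem_range.2 (Nat.lt_succ_iff.2 h))), mul_zero]
    simp_rw [h]
    rw [ENNReal.tsum_comm]
    simp_rw [ENNReal.tsum_mul_left]
  rw [swap, swap]
  exact ENNReal.tsum_le_tsum fun k => mul_le_mul_right (htail k) _

/-- Entropy is monotone under majorization of probability vectors. -/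
lemma tsum_sh_le_tsum_sh_of_majorize {p a : ℕ → ℝ≥0∞} (ha : Antitone a)
    (hp1 : ∑' i, p i = 1) (ha1 : ∑' i, a i = 1)
    (hpa : ∀ n, ∑ i ∈ Finset.range n, a i ≤ ∑ i ∈ Finset.range n, p i) :
    ∑' i, ENNReal.ofReal (sh (p i).toReal) ≤ ∑' i, ENNReal.ofReal (sh (a i).toReal) := by
  have hple (i : ℕ) : p i ≤ 1 := hp1 ▸ ENNReal.le_tsum i
  have hale (i : ℕ) : a i ≤ 1 := ha1 ▸ ENNReal.le_tsum i
  have htail (k : ℕ) :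
      ∑' i, (if k ≤ i then p i else 0) ≤ ∑' i, (if k ≤ i then a i else 0) := by
    have h1 := sum_range_add_tsum_ite p k
    have h2 := sum_range_add_tsum_ite a k
    have hfin : ∑ i ∈ Finset.range k, p i ≠ ⊤ :=
      ne_top_of_le_ne_top one_ne_top (hp1 ▸ ENNReal.sum_le_tsum _)
    refine (ENNReal.add_le_add_iff_left hfin).1 ?_
    rw [h1, hp1, ← ha1, ← h2]
    exact add_le_add_left (hpa k) _
  have gibbs : ∑' i, ENNReal.ofReal (sh (p i).toReal) ≤ ∑' i, p i * infoContent (a i) := by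
    have h := ENNReal.tsum_le_tsum fun i => sh_add_le_mul_infoContent_add (hple i) (hale i)
    rw [ENNReal.tsum_add, ENNReal.tsum_add, ENNReal.tsum_mul_right (f := p),
      ENNReal.tsum_mul_right (f := a), hp1, ha1, one_mul] at h
    exact (ENNReal.add_le_add_iff_right ENNReal.ofReal_ne_top).1 h
  calc _ ≤ _ := gibbs
    _ ≤ ∑' i, a i * infoContent (a i) := tsum_mul_le_tsum_mul_of_monotone
        (fun i j hij => infoContent_le_of_le (hale i) (ha hij)) htail
    _ = _ := tsum_congr fun i => mul_infoContent_self (hale i)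

/-- Every point of `⋃ Q i` lies in the piece given by its least index. -/
lemma exists_mem_diff_of_mem {X : Type*} (I : Set ℕ) (Q : ℕ → Set X) {x : X} {i : ℕ}
    (hi : i ∈ I) (hx : x ∈ Q i) :
    ∃ j ∈ I, j ≤ i ∧ x ∈ Q j \ ⋃ k ∈ I ∩ Set.Iio j, Q k := by
  classical
  have hex : ∃ j, j ∈ I ∧ x ∈ Q j := ⟨i, hi, hx⟩
  refine ⟨Nat.find hex, (Nat.find_spec hex).1, Nat.find_min' hex ⟨hi, hx⟩,
    (Nat.find_spec hex).2, ?_⟩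
  simp only [Set.mem_iUnion, not_exists]
  exact fun k hk hxk => Nat.find_min hex hk.2 ⟨hk.1, hxk⟩

/-- Entropy sums over `I` as sums over `ℕ` of the extension by zero. -/
lemma tsum_subtype_sh (I : Set ℕ) (f : ℕ → ℝ≥0∞) :
    ∑' i : I, ENNReal.ofReal (sh (f i).toReal) =
      ∑' i, ENNReal.ofReal (sh (I.indicator f i).toReal) := by
  rw [tsum_subtype I fun i => ENNReal.ofReal (sh (f i).toReal)]
  refine tsum_congr fun i => ?_
  by_cases hi : i ∈ I <;> simp [hi, sh_zero]

/-- Proposition 2 of the paper. `Q = {Q_i}_{i∈I}` is an indexed family of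
measurable sets (with `I = ℕ` or `I = {0,…,N-1}`), `m ∈ V(μ;Q)` (i.e. `m_i(X \ Q_i) = 0` and
`Σ_{i∈I} m_i = μ`), `μ(X \ ⋃_i Q_i) = 0`, and `i ↦ m_i(X)` is nonincreasing.  With
`P_i := Q_i \ ⋃_{k∈I, k<i} Q_k`, the family `P = {P_i}_{i∈I}` is a `μ`-partition, `P ≺ Q`
(namely `P_i ⊆ Q_i`), and `hv(μ;m) ≥ h(μ;P)`. -/
theorem exists_partition_of_weighting {X : Type*} [MeasurableSpace X]
    (μ : Measure X) [IsProbabilityMeasure μ]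
    (I : Set ℕ) (hI : I = Set.univ ∨ ∃ N : ℕ, I = Set.Iio N)
    (Q : ℕ → Set X) (hQmeas : ∀ i ∈ I, MeasurableSet (Q i))
    (m : ℕ → Measure X)
    (hm0 : ∀ i ∈ I, m i (Q i)ᶜ = 0)
    (hmsum : Measure.sum (fun i : I => m (i : ℕ)) = μ)
    (hcover : μ (⋃ i ∈ I, Q i)ᶜ = 0)
    (hmono : ∀ i ∈ I, ∀ j ∈ I, i ≤ j → m j Set.univ ≤ m i Set.univ)
    (P : ℕ → Set X) (hP : ∀ i, P i = Q i \ ⋃ k ∈ I ∩ Set.Iio i, Q k) :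
    (∀ i ∈ I, ∀ j ∈ I, i ≠ j → Disjoint (P i) (P j)) ∧
    μ (⋃ i ∈ I, P i)ᶜ = 0 ∧
    (∀ i ∈ I, P i ⊆ Q i) ∧
    ∑' i : I, ENNReal.ofReal (sh ((μ (P i)).toReal)) ≤
      ∑' i : I, ENNReal.ofReal (sh ((m i Set.univ).toReal)) := by
  classical
  have hlower : IsLowerSet I := by
    rcases hI with rfl | ⟨N, rfl⟩
    · exact isLowerSet_univ
    · exact isLowerSet_Iio N
  have hPQ (i : ℕ) : P i ⊆ Q i := hP i ▸ Set.sdiff_subset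
  have hdisj_lt {i j : ℕ} (hi : i ∈ I) (hij : i < j) : Disjoint (P i) (P j) := by
    refine Set.disjoint_left.2 fun x hxi hxj => ?_
    rw [hP j] at hxj
    exact hxj.2 (Set.mem_biUnion (⟨hi, hij⟩ : i ∈ I ∩ Set.Iio j) (hPQ i hxi))
  have hdisj : ∀ i ∈ I, ∀ j ∈ I, i ≠ j → Disjoint (P i) (P j) := fun i hi j hj hij =>
    hij.lt_or_gt.elim (hdisj_lt hi) fun h => (hdisj_lt hj h).symm
  have hUnion : ⋃ i ∈ I, P i = ⋃ i ∈ I, Q i := by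
    refine (Set.iUnion₂_mono fun i _ => hPQ i).antisymm (Set.iUnion₂_subset fun i hi x hx => ?_)
    obtain ⟨j, hj, -, hxj⟩ := exists_mem_diff_of_mem I Q hi hx
    exact Set.mem_biUnion hj (hP j ▸ hxj)
  have hPmeas : ∀ i ∈ I, MeasurableSet (P i) := fun i hi => hP i ▸
    (hQmeas i hi).diff (MeasurableSet.biUnion (Set.to_countable _) fun k hk => hQmeas k hk.1)
  have hPnull : μ (⋃ i ∈ I, P i)ᶜ = 0 := hUnion ▸ hcover
  refine ⟨hdisj, hPnull, fun i _ => hPQ i, ?_⟩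
  rw [tsum_subtype_sh I fun i => μ (P i), tsum_subtype_sh I fun i => m i Set.univ]
  apply tsum_sh_le_tsum_sh_of_majorize
  · intro i j hij
    by_cases hj : j ∈ I
    · have hi : i ∈ I := hlower hij hj
      simpa [hi, hj] using hmono i hi j hj hij
    · simp [hj]
  · rw [← tsum_subtype I fun i => μ (P i), ← measure_biUnion (Set.to_countable I)
      (fun i hi j hj hij => hdisj i hi j hj hij) hPmeas]
    exact (prob_compl_eq_zero_iff
      (MeasurableSet.biUnion (Set.to_countable I) hPmeas)).1 hPnull
  · rw [← tsum_subtype I fun i => m i Set.univ,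
      ← Measure.sum_apply (fun i : I => m i) MeasurableSet.univ, hmsum, measure_univ]
  · intro n
    set U : Set X := ⋃ k ∈ I ∩ Set.Iio n, Q k with hU
    have hfull (i : ℕ) (hi : i < n) :
        I.indicator (fun i => m i Set.univ) i ≤ I.indicator (fun i => m i U) i := by
      by_cases hiI : i ∈ I
      · have hsub : Q i ⊆ U :=
          Set.subset_biUnion_of_mem (u := Q) (⟨hiI, hi⟩ : i ∈ I ∩ Set.Iio n)
        have hnull : m i Uᶜ = 0 :=
          measure_mono_null (Set.compl_subset_compl.2 hsub) (hm0 i hiI)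
        have := measure_union_le (μ := m i) U Uᶜ
        simpa [hiI, hnull] using this
      · simp [hiI]
    calc ∑ i ∈ Finset.range n, I.indicator (fun i => m i Set.univ) i
        ≤ ∑ i ∈ Finset.range n, I.indicator (fun i => m i U) i :=
          Finset.sum_le_sum fun i hi => hfull i (Finset.mem_range.1 hi)
      _ ≤ ∑' i, I.indicator (fun i => m i U) i := ENNReal.sum_le_tsum _
      _ = ∑' i : I, m i U := (tsum_subtype I fun i => m i U).symm
      _ ≤ μ U := hmsum ▸ Measure.le_sum_apply (fun i : I => m i) U
      _ ≤ μ (⋃ i ∈ Finset.range n, if i ∈ I then P i else ∅) := by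
          refine measure_mono (Set.iUnion₂_subset fun i hi x hx => ?_)
          obtain ⟨j, hj, hji, hxj⟩ := exists_mem_diff_of_mem I Q hi.1 hx
          refine Set.mem_biUnion (x := j) (Finset.mem_range.2 (hji.trans_lt hi.2)) ?_
          simpa [hj, hP j] using hxj
      _ ≤ ∑ i ∈ Finset.range n, μ (if i ∈ I then P i else ∅) := measure_biUnion_finset_le _ _
      _ = ∑ i ∈ Finset.range n, I.indicator (fun i => μ (P i)) i :=
          Finset.sum_congr rfl fun i _ => by by_cases hi : i ∈ I <;> simp [hi]
end

section
/- Let (X, Σ) be a measurable space, n ∈ ℕ, a₁,…,aₙ ∈ (0,1) with Σ_{k=1}^n a_k = 1, let μ₁,…,μₙ be probability measures on (X,Σ), and put μ := Σ_{k=1}^n a_k μ_k. Let Q ⊆ Σ and suppose m^k ∈ V(μ_k;Q) for each k ∈ {1,…,n}. Then m := Σ_{k=1}^n a_k m^k belongs to V(μ;Q) and hv(μ;m) ≤ Σ_{k=1}^n a_k hv(μ_k;m^k) + Σ_{k=1}^n sh(a_k). -/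
open MeasureTheory ENNReal

/-- The Shannon function is subadditive on finite families of nonnegative reals. -/
theorem sh_sum_le {ι : Type*} (s : Finset ι) (y : ι → ℝ) (hy : ∀ i ∈ s, 0 ≤ y i) :
    sh (∑ i ∈ s, y i) ≤ ∑ i ∈ s, sh (y i) := by
  unfold sh
  rw [Finset.sum_neg_distrib, neg_le_neg_iff, Finset.sum_mul]
  refine Finset.sum_le_sum fun i hi => ?_
  rcases (hy i hi).eq_or_lt with h | h
  · simp [← h]
  · exact mul_le_mul_of_nonneg_left
      (Real.logb_le_logb_of_le one_lt_two h (Finset.single_le_sum hy hi)) h.le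

theorem sh_mul (x y : ℝ) : sh (x * y) = x * sh y + y * sh x := by
  unfold sh
  rcases eq_or_ne x 0 with rfl | hx
  · simp
  rcases eq_or_ne y 0 with rfl | hy
  · simp
  rw [Real.logb_mul hx hy]
  ring

theorem ENNReal.ofReal_sum_le {ι : Type*} (s : Finset ι) (f : ι → ℝ) :
    ENNReal.ofReal (∑ i ∈ s, f i) ≤ ∑ i ∈ s, ENNReal.ofReal (f i) :=
  Finset.le_sum_of_subadditive _ ENNReal.ofReal_zero.le (fun _ _ => ENNReal.ofReal_add_le) s f

theorem IsWeighting.tsum_univ {X : Type*} [MeasurableSpace X] {μ : Measure X} {Q : Set (Set X)}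
    {m : Q → Measure X} (h : IsWeighting μ Q m) : ∑' q, m q Set.univ = μ Set.univ := by
  rw [← h.2, Measure.sum_apply _ MeasurableSet.univ]

theorem IsWeighting.apply_univ_ne_top {X : Type*} [MeasurableSpace X] {μ : Measure X}
    [IsFiniteMeasure μ] {Q : Set (Set X)} {m : Q → Measure X} (h : IsWeighting μ Q m) (q : Q) :
    m q Set.univ ≠ ⊤ :=
  ENNReal.ne_top_of_tsum_ne_top (h.tsum_univ ▸ measure_ne_top μ _) q

theorem IsWeighting.sum_smul {X ι : Type*} [MeasurableSpace X] [Fintype ι] {μ : ι → Measure X}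
    {Q : Set (Set X)} {m : ι → Q → Measure X} (hm : ∀ k, IsWeighting (μ k) Q (m k))
    (c : ι → ℝ≥0∞) : IsWeighting (∑ k, c k • μ k) Q (fun q => ∑ k, c k • m k q) := by
  refine ⟨fun q => ?_, ?_⟩
  · simp [Measure.finsetSum_apply, (hm _).1 q]
  · ext s hs
    simp only [Measure.sum_apply _ hs, Measure.finsetSum_apply, Measure.smul_apply, smul_eq_mul,
      ← (hm _).2]
    rw [Summable.tsum_finsetSum fun _ _ => ENNReal.summable]
    simp only [ENNReal.tsum_mul_left]

/-- The entropy contribution of a single set to a mixture of weightings. -/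
theorem ofReal_sh_sum_smul_le {X ι : Type*} [MeasurableSpace X] [Fintype ι] {a : ι → ℝ}
    (ha : ∀ k, 0 ≤ a k) {ν : ι → Measure X} (hν : ∀ k, ν k Set.univ ≠ ⊤) :
    ENNReal.ofReal (sh ((∑ k, ENNReal.ofReal (a k) • ν k) Set.univ).toReal) ≤
      ∑ k, (ENNReal.ofReal (a k) * ENNReal.ofReal (sh (ν k Set.univ).toReal) +
        ν k Set.univ * ENNReal.ofReal (sh (a k))) := by
  have hmass : ((∑ k, ENNReal.ofReal (a k) • ν k) Set.univ).toReal =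
      ∑ k, a k * (ν k Set.univ).toReal := by
    simp only [Measure.finsetSum_apply, Measure.smul_apply, smul_eq_mul]
    rw [ENNReal.toReal_sum fun k _ => ENNReal.mul_ne_top ENNReal.ofReal_ne_top (hν k)]
    simp only [ENNReal.toReal_mul, ENNReal.toReal_ofReal (ha _)]
  rw [hmass]
  refine (ENNReal.ofReal_le_ofReal (sh_sum_le _ _ fun k _ =>
    mul_nonneg (ha k) ENNReal.toReal_nonneg)).trans ((ENNReal.ofReal_sum_le _ _).trans ?_)
  refine Finset.sum_le_sum fun k _ => ?_
  rw [sh_mul]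
  refine ENNReal.ofReal_add_le.trans_eq ?_
  rw [ENNReal.ofReal_mul (ha k), ENNReal.ofReal_mul ENNReal.toReal_nonneg,
    ENNReal.ofReal_toReal (hν k)]

/-- second part of Proposition 3 of the paper: if `m^k ∈ V(μ_k;Q)` for each
`k`, then `m := Σ_k a_k m^k ∈ V(Σ_k a_k μ_k; Q)` and
`hv(μ;m) ≤ Σ_k a_k hv(μ_k;m^k) + Σ_k sh(a_k)`. -/
theorem wEntropy_mixture_le {X : Type*} [MeasurableSpace X]
    (n : ℕ) (a : Fin n → ℝ) (ha : ∀ k, a k ∈ Set.Ioo (0 : ℝ) 1) (hsum : ∑ k, a k = 1)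
    (μ : Fin n → Measure X) (hμ : ∀ k, IsProbabilityMeasure (μ k))
    (Q : Set (Set X)) (hQ : ∀ q ∈ Q, MeasurableSet q)
    (m : Fin n → Q → Measure X) (hm : ∀ k, IsWeighting (μ k) Q (m k)) :
    IsWeighting (∑ k, ENNReal.ofReal (a k) • μ k) Q
      (fun q => ∑ k, ENNReal.ofReal (a k) • m k q) ∧
    wEntropy Q (fun q => ∑ k, ENNReal.ofReal (a k) • m k q) ≤
      ∑ k, ENNReal.ofReal (a k) * wEntropy Q (m k) + ∑ k, ENNReal.ofReal (sh (a k)) := by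
  refine ⟨IsWeighting.sum_smul hm _, ?_⟩
  unfold wEntropy
  refine (ENNReal.tsum_le_tsum fun q => ofReal_sh_sum_smul_le (fun k => (ha k).1.le)
    fun k => (hm k).apply_univ_ne_top q).trans_eq ?_
  rw [Summable.tsum_finsetSum fun _ _ => ENNReal.summable, ← Finset.sum_add_distrib]
  refine Finset.sum_congr rfl fun k _ => ?_
  rw [ENNReal.tsum_add, ENNReal.tsum_mul_left, ENNReal.tsum_mul_right, (hm k).tsum_univ,
    measure_univ, one_mul]
end

section
/- Let (X, Σ) be a measurable space, n ∈ ℕ, a₁,…,aₙ ∈ [0,1] with Σ_{k=1}^n a_k = 1, and let μ₁,…,μₙ be probability measures on (X,Σ). Then for every family Q ⊆ Σ, H(Σ_{k=1}^n a_k μ_k; Q) ≥ Σ_{k=1}^n a_k H(μ_k;Q). -/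
open MeasureTheory ENNReal

theorem sh_eq_negMulLog_div (x : ℝ) : sh x = (Real.log 2)⁻¹ * Real.negMulLog x := by
  simp only [sh, Real.logb, Real.negMulLog]
  ring

theorem concaveOn_sh : ConcaveOn ℝ (Set.Ici 0) sh := by
  have h := Real.concaveOn_negMulLog.smul (inv_nonneg.2 (Real.log_nonneg one_le_two))
  exact h.congr fun x _ => (sh_eq_negMulLog_div x).symm

theorem sh_nonneg {x : ℝ} (h₀ : 0 ≤ x) (h₁ : x ≤ 1) : 0 ≤ sh x := by
  rw [sh_eq_negMulLog_div]
  exact mul_nonneg (inv_nonneg.2 (Real.log_nonneg one_le_two)) (Real.negMulLog_nonneg h₀ h₁)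

section Mixture

variable {X ι : Type*} [MeasurableSpace X] [Fintype ι] {a : ι → ℝ} {μ : ι → Measure X}

theorem toReal_mixture_apply (ha : ∀ k, 0 ≤ a k) [∀ k, IsFiniteMeasure (μ k)] (s : Set X) :
    ((∑ k, ENNReal.ofReal (a k) • μ k) s).toReal = ∑ k, a k * (μ k s).toReal := by
  rw [Measure.finsetSum_apply, ENNReal.toReal_sum]
  · simp [ENNReal.toReal_ofReal (ha _)]
  · intro k _
    exact ENNReal.mul_ne_top ENNReal.ofReal_ne_top (measure_ne_top _ _)

/-- Concavity of the entropy of a fixed family of sets. -/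
theorem sum_mul_partEntropy_le (ha : ∀ k, 0 ≤ a k) (hsum : ∑ k, a k = 1)
    [∀ k, IsProbabilityMeasure (μ k)] (P : Set (Set X)) :
    ∑ k, ENNReal.ofReal (a k) * partEntropy (μ k) P ≤
      partEntropy (∑ k, ENNReal.ofReal (a k) • μ k) P := by
  simp only [partEntropy, ← ENNReal.tsum_mul_left]
  rw [← Summable.tsum_finsetSum fun _ _ => ENNReal.summable]
  refine ENNReal.tsum_le_tsum fun s => ?_
  simp only [← ENNReal.ofReal_mul (ha _)]
  rw [← ENNReal.ofReal_sum_of_nonneg fun k _ => mul_nonneg (ha k)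
    (sh_nonneg ENNReal.toReal_nonneg measureReal_le_one), toReal_mixture_apply ha]
  exact ENNReal.ofReal_le_ofReal <| concaveOn_sh.le_map_sum (fun k _ => ha k) hsum
    fun k _ => ENNReal.toReal_nonneg

theorem IsMuPartition.of_mixture {P : Set (Set X)}
    (hP : IsMuPartition (∑ k, ENNReal.ofReal (a k) • μ k) P) {k : ι} (hk : 0 < a k) :
    IsMuPartition (μ k) P := by
  obtain ⟨hc, hm, hd, h⟩ := hP
  refine ⟨hc, hm, hd, ?_⟩
  rw [Measure.finsetSum_apply, Finset.sum_eq_zero_iff] at h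
  simpa [hk.not_ge] using h k (Finset.mem_univ k)

end Mixture

/-- inequality (24) of Theorem 2 of the paper:
`H(Σ_k a_k μ_k; Q) ≥ Σ_k a_k H(μ_k;Q)`. -/
theorem entropyH_mixture_ge {X : Type*} [MeasurableSpace X]
    (n : ℕ) (a : Fin n → ℝ) (ha : ∀ k, a k ∈ Set.Icc (0 : ℝ) 1) (hsum : ∑ k, a k = 1)
    (μ : Fin n → Measure X) (hμ : ∀ k, IsProbabilityMeasure (μ k))
    (Q : Set (Set X)) (hQ : ∀ q ∈ Q, MeasurableSet q) :
    ∑ k, ENNReal.ofReal (a k) * entropyH (μ k) Q ≤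
      entropyH (∑ k, ENNReal.ofReal (a k) • μ k) Q := by
  have ha₀ : ∀ k, 0 ≤ a k := fun k => (ha k).1
  refine le_iInf fun P => le_iInf fun hP => le_iInf fun hPQ => ?_
  refine le_trans (Finset.sum_le_sum fun k _ => ?_) (sum_mul_partEntropy_le ha₀ hsum P)
  rcases (ha₀ k).eq_or_lt with hk | hk
  · simp [← hk]
  · gcongr
    exact iInf_le_of_le P <| iInf_le_of_le (hP.of_mixture hk) <| iInf_le _ hPQ
end
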